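/- There is no finite simple cubic girth-regular graph of girth 6 whose signature (a, b, c) satisfies c = 7; equivalently, in a cubic girth-regular graph of girth 6, no edge lies on exactly 7 six-cycles while being the edge of maximal girth-cycle count at each of its endpoints. -/

import Mathlib

/-- The number of cycles of length 6 in `G` (identified with their edge sets)
that contain the edge `e`. -/
noncomputable def sixCycleCount {V : Type*} (G : SimpleGraph V) (e : Sym2 V) : ℕ :=
  Set.ncard {s : Set (Sym2 V) |
    (∃ (v : V) (w : G.Walk v v), w.IsCycle ∧ w.length = 6 ∧ s = {e' | e' ∈ w.edges}) ∧ e ∈ s}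

/-- A cubic graph of girth 6 is girth-regular with signature `(a, b, c)` if every vertex is
incident with exactly three edges, on which the numbers of girth cycles (6-cycles) are
`a`, `b`, `c` respectively. -/
def hasSignature {V : Type*} (G : SimpleGraph V) (a b c : ℕ) : Prop :=
  ∀ v : V, ∃ e₁ e₂ e₃ : Sym2 V, e₁ ≠ e₂ ∧ e₁ ≠ e₃ ∧ e₂ ≠ e₃ ∧
    G.incidenceSet v = {e₁, e₂, e₃} ∧
    sixCycleCount G e₁ = a ∧ sixCycleCount G e₂ = b ∧ sixCycleCount G e₃ = c

/-- The incidence pattern of the path with eight vertices between two families of four vertices,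
each split into two pairs: the ends of the path are `(i, j)` and `(k, l)`. -/
def IsPathPattern (M : Fin 2 → Fin 2 → Fin 2 → Fin 2 → Bool) (i j k l : Fin 2) : Prop :=
  (∃ k₀ l₀, M i j k₀ l₀ ∧ ∀ k' l', M i j k' l' → k' = k₀ ∧ l' = l₀) ∧
  (∀ i' j', (i' = i → j' ≠ j) → ∃ l₀ l₁, M i' j' 0 l₀ ∧ M i' j' 1 l₁) ∧
  (∀ k' l', (k' = k → l' ≠ l) → ∃ j₀ j₁, M 0 j₀ k' l' ∧ M 1 j₁ k' l') ∧
  (∀ l', ¬ M i j k l') ∧ (∀ j', ¬ M i j' k l) ∧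
  ∀ i' j' k' l', M i j k' l' → M i' j' k' l' → ¬ M i' j' k l

instance (M : Fin 2 → Fin 2 → Fin 2 → Fin 2 → Bool) (i j k l : Fin 2) :
    Decidable (IsPathPattern M i j k l) := by
  unfold IsPathPattern
  infer_instance

/-- The pattern with the given rows. -/
def boolMatrix (a₀ a₁ a₂ a₃ b₀ b₁ b₂ b₃ c₀ c₁ c₂ c₃ d₀ d₁ d₂ d₃ : Bool) :
    Fin 2 → Fin 2 → Fin 2 → Fin 2 → Bool :=
  ![![![![a₀, a₁], ![a₂, a₃]], ![![b₀, b₁], ![b₂, b₃]]],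
    ![![![c₀, c₁], ![c₂, c₃]], ![![d₀, d₁], ![d₂, d₃]]]]

set_option synthInstance.maxHeartbeats 400000 in
set_option synthInstance.maxSize 100000 in
theorem exists_isPathPattern_of_rows :
    ∀ a₀ a₁, (a₀ && a₁) = false → ∀ a₂ a₃, (a₂ && a₃) = false →
    ∀ b₀ b₁, (b₀ && b₁) = false → (a₀ && b₀) = false → (a₁ && b₁) = false →
    ∀ b₂ b₃, (b₂ && b₃) = false → (a₂ && b₂) = false → (a₃ && b₃) = false →
    3 ≤ a₀.toNat + a₁.toNat + (a₂.toNat + a₃.toNat) +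
      (b₀.toNat + b₁.toNat + (b₂.toNat + b₃.toNat)) →
    ∀ c₀ c₁, (c₀ && c₁) = false → ∀ c₂ c₃, (c₂ && c₃) = false →
    ((a₀ && c₀ || a₁ && c₁) && (a₂ && c₂ || a₃ && c₃)) = false →
    ((b₀ && c₀ || b₁ && c₁) && (b₂ && c₂ || b₃ && c₃)) = false →
    ∀ d₀ d₁, (d₀ && d₁) = false → (c₀ && d₀) = false → (c₁ && d₁) = false →
    ∀ d₂ d₃, (d₂ && d₃) = false → (c₂ && d₂) = false → (c₃ && d₃) = false →
    ((a₀ && d₀ || a₁ && d₁) && (a₂ && d₂ || a₃ && d₃)) = false →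
    ((b₀ && d₀ || b₁ && d₁) && (b₂ && d₂ || b₃ && d₃)) = false →
    a₀.toNat + a₁.toNat + (a₂.toNat + a₃.toNat) + (b₀.toNat + b₁.toNat + (b₂.toNat + b₃.toNat)) +
      (c₀.toNat + c₁.toNat + (c₂.toNat + c₃.toNat) +
        (d₀.toNat + d₁.toNat + (d₂.toNat + d₃.toNat))) = 7 →
    ∃ i j k l, IsPathPattern
      (boolMatrix a₀ a₁ a₂ a₃ b₀ b₁ b₂ b₃ c₀ c₁ c₂ c₃ d₀ d₁ d₂ d₃) i j k l := by
  decide +kernel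

theorem exists_isPathPattern (M : Fin 2 → Fin 2 → Fin 2 → Fin 2 → Bool)
    (hrow : ∀ i j k, (M i j k 0 && M i j k 1) = false)
    (hcol : ∀ i k l, (M i 0 k l && M i 1 k l) = false)
    (hquad : ∀ i j i' j' k l k' l', M i j k l → M i j k' l' → M i' j' k l → M i' j' k' l' →
      (i = i' ∧ j = j') ∨ (k = k' ∧ l = l'))
    (hcard : ∑ i, ∑ j, ∑ k, ∑ l, (M i j k l).toNat = 7) :
    ∃ i j k l, IsPathPattern M i j k l := by
  have hM : M = boolMatrix
      (M 0 0 0 0) (M 0 0 0 1) (M 0 0 1 0) (M 0 0 1 1) (M 0 1 0 0) (M 0 1 0 1) (M 0 1 1 0)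
      (M 0 1 1 1) (M 1 0 0 0) (M 1 0 0 1) (M 1 0 1 0) (M 1 0 1 1) (M 1 1 0 0) (M 1 1 0 1)
      (M 1 1 1 0) (M 1 1 1 1) := by
    ext i j k l
    fin_cases i <;> fin_cases j <;> fin_cases k <;> fin_cases l <;> rfl
  have hle : ∀ i j k, (M i j k 0).toNat + (M i j k 1).toNat ≤ 1 := by
    intro i j k
    have := hrow i j k
    revert this
    cases M i j k 0 <;> cases M i j k 1 <;> simp
  have hno : ∀ j j', ((M 0 j 0 0 && M 1 j' 0 0 || M 0 j 0 1 && M 1 j' 0 1) &&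
      (M 0 j 1 0 && M 1 j' 1 0 || M 0 j 1 1 && M 1 j' 1 1)) = false := by
    intro j j'
    have := fun l l' ↦ hquad 0 j 1 j' 0 l 1 l'
    rw [Bool.eq_false_iff]
    grind
  simp only [Fin.sum_univ_two] at hcard
  have h3 := hle 1 0 0
  have h4 := hle 1 0 1
  have h5 := hle 1 1 0
  have h6 := hle 1 1 1
  have := exists_isPathPattern_of_rows _ _ (hrow 0 0 0) _ _ (hrow 0 0 1) _ _ (hrow 0 1 0)
    (hcol 0 0 0) (hcol 0 0 1) _ _ (hrow 0 1 1) (hcol 0 1 0) (hcol 0 1 1) (by omega)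
    _ _ (hrow 1 0 0) _ _ (hrow 1 0 1) (hno 0 0) (hno 1 0)
    _ _ (hrow 1 1 0) (hcol 1 0 0) (hcol 1 0 1)
    _ _ (hrow 1 1 1) (hcol 1 1 0) (hcol 1 1 1) (hno 0 1) (hno 1 1) hcard
  rwa [← hM] at this

namespace SimpleGraph

variable {V : Type*} {G : SimpleGraph V}

theorem not_adj_of_six_le_girth_of_triangle (hg : 6 ≤ G.girth) {a b c : V} (hab : G.Adj a b)
    (hbc : G.Adj b c) : ¬ G.Adj c a := by
  intro hca
  have hw : (Walk.cons hab (.cons hbc (.cons hca .nil))).IsCycle := by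
    have := hab.ne; have := hbc.ne; have := hca.ne
    simp [Walk.cons_isCycle_iff, Walk.cons_isPath_iff]
    grind
  have := hg.trans (girth_le_length hw)
  simp at this

theorem eq_or_eq_of_six_le_girth (hg : 6 ≤ G.girth) {a b c d : V} (hab : G.Adj a b)
    (hbc : G.Adj b c) (hcd : G.Adj c d) (hda : G.Adj d a) : a = c ∨ b = d := by
  by_contra! h
  have hw : (Walk.cons hab (.cons hbc (.cons hcd (.cons hda .nil)))).IsCycle := by
    have := hab.ne; have := hbc.ne; have := hcd.ne; have := hda.ne
    simp [Walk.cons_isCycle_iff, Walk.cons_isPath_iff]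
    grind
  have := hg.trans (girth_le_length hw)
  simp at this

theorem not_adj_of_six_le_girth_of_pentagon (hg : 6 ≤ G.girth) {a b c d e : V} (hab : G.Adj a b)
    (hbc : G.Adj b c) (hcd : G.Adj c d) (hde : G.Adj d e) : ¬ G.Adj e a := by
  intro hea
  have hac : a ≠ c := fun h ↦ not_adj_of_six_le_girth_of_triangle hg hcd hde (h ▸ hea)
  have hbd : b ≠ d := fun h ↦ not_adj_of_six_le_girth_of_triangle hg hab (h ▸ hde) hea
  have hce : c ≠ e := fun h ↦ not_adj_of_six_le_girth_of_triangle hg hab hbc (h ▸ hea)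
  have hda : d ≠ a := fun h ↦ not_adj_of_six_le_girth_of_triangle hg hbc hcd (h ▸ hab)
  have heb : e ≠ b := fun h ↦ not_adj_of_six_le_girth_of_triangle hg hbc hcd (h ▸ hde)
  have hw : (Walk.cons hab (.cons hbc (.cons hcd (.cons hde (.cons hea .nil))))).IsCycle := by
    have := hab.ne; have := hbc.ne; have := hcd.ne; have := hde.ne; have := hea.ne
    simp [Walk.cons_isCycle_iff, Walk.cons_isPath_iff]
    grind
  have := hg.trans (girth_le_length hw)
  simp at this

/-- The vertices `a, b, c, d, e, f` form a closed walk of length six in which no two consecutive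
edges agree. -/
structure IsHexagon (G : SimpleGraph V) (a b c d e f : V) : Prop where
  ab : G.Adj a b
  bc : G.Adj b c
  cd : G.Adj c d
  de : G.Adj d e
  ef : G.Adj e f
  fa : G.Adj f a
  ac : a ≠ c
  bd : b ≠ d
  ce : c ≠ e
  df : d ≠ f
  ea : e ≠ a
  fb : f ≠ b

/-- The edges of the hexagon `a, b, c, d, e, f`. -/
def hexagonEdges (a b c d e f : V) : Set (Sym2 V) :=
  {s(a, b), s(b, c), s(c, d), s(d, e), s(e, f), s(f, a)}

theorem IsHexagon.rotate {a b c d e f : V} (h : G.IsHexagon a b c d e f) :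
    G.IsHexagon b c d e f a :=
  ⟨h.bc, h.cd, h.de, h.ef, h.fa, h.ab, h.bd, h.ce, h.df, h.ea, h.fb, h.ac⟩

theorem IsHexagon.reverse {a b c d e f : V} (h : G.IsHexagon a b c d e f) :
    G.IsHexagon f e d c b a :=
  ⟨h.ef.symm, h.de.symm, h.cd.symm, h.bc.symm, h.ab.symm, h.fa.symm, h.df.symm, h.ce.symm,
    h.bd.symm, h.ac.symm, h.fb.symm, h.ea.symm⟩

theorem hexagonEdges_rotate (a b c d e f : V) :
    hexagonEdges b c d e f a = hexagonEdges a b c d e f := by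
  ext x
  simp only [hexagonEdges, Set.mem_insert_iff, Set.mem_singleton_iff]
  tauto

theorem hexagonEdges_reverse (a b c d e f : V) :
    hexagonEdges f e d c b a = hexagonEdges a b c d e f := by
  ext x
  simp only [hexagonEdges, Set.mem_insert_iff, Set.mem_singleton_iff,
    Sym2.eq_swap (a := f) (b := e), Sym2.eq_swap (a := e) (b := d), Sym2.eq_swap (a := d) (b := c),
    Sym2.eq_swap (a := c) (b := b), Sym2.eq_swap (a := b) (b := a), Sym2.eq_swap (a := a) (b := f)]
  tauto

/-- In a graph of girth at least six, the cycles of length six are exactly the hexagons. -/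
theorem exists_isCycle_length_eq_six_iff (hg : 6 ≤ G.girth) (s : Set (Sym2 V)) :
    (∃ (v : V) (w : G.Walk v v), w.IsCycle ∧ w.length = 6 ∧ s = {e' | e' ∈ w.edges}) ↔
      ∃ a b c d e f, G.IsHexagon a b c d e f ∧ s = hexagonEdges a b c d e f := by
  constructor
  · rintro ⟨a, w, hw, hl, rfl⟩
    match w, hl with
    | .cons (v := b) hab (.cons (v := c) hbc (.cons (v := d) hcd (.cons (v := e) hde
        (.cons (v := f) hef (.cons hfa .nil))))), _ =>
      refine ⟨a, b, c, d, e, f, ?_, ?_⟩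
      · simp [Walk.cons_isCycle_iff, Walk.cons_isPath_iff] at hw
        constructor <;> grind
      · ext x
        simp [hexagonEdges]
  · rintro ⟨a, b, c, d, e, f, h, rfl⟩
    have had : a ≠ d := fun had ↦
      not_adj_of_six_le_girth_of_triangle hg h.ab h.bc (had ▸ h.cd)
    have hbe : b ≠ e := fun hbe ↦
      not_adj_of_six_le_girth_of_triangle hg h.bc h.cd (hbe ▸ h.de)
    have hcf : c ≠ f := fun hcf ↦
      not_adj_of_six_le_girth_of_triangle hg h.cd h.de (hcf ▸ h.ef)
    refine ⟨a, .cons h.ab (.cons h.bc (.cons h.cd (.cons h.de (.cons h.ef (.cons h.fa .nil))))),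
      ?_, rfl, ?_⟩
    · have := h.ab.ne; have := h.bc.ne; have := h.cd.ne; have := h.de.ne; have := h.ef.ne
      have := h.fa.ne; have := h.ac; have := h.bd; have := h.ce; have := h.df; have := h.ea
      have := h.fb
      simp [Walk.cons_isCycle_iff, Walk.cons_isPath_iff]
      grind
    · ext x
      simp [hexagonEdges]

theorem IsHexagon.exists_of_mem {a b c d e f u v : V} (h : G.IsHexagon a b c d e f)
    (hm : s(u, v) ∈ hexagonEdges a b c d e f) :
    ∃ p x y q, G.IsHexagon u p x y q v ∧ hexagonEdges a b c d e f = hexagonEdges u p x y q v := by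
  wlog hfa : s(u, v) = s(f, a) generalizing a b c d e f
  · have key : ∀ {a b c d e f : V}, G.IsHexagon a b c d e f → s(u, v) = s(f, a) →
      ∃ p x y q, G.IsHexagon u p x y q v ∧
        hexagonEdges a b c d e f = hexagonEdges u p x y q v :=
      fun h h' ↦ this h (by simp [hexagonEdges, h']) h'
    simp only [hexagonEdges, Set.mem_insert_iff, Set.mem_singleton_iff] at hm
    rcases hm with hm | hm | hm | hm | hm | hm
    · simpa only [hexagonEdges_rotate] using key h.rotate hm
    · simpa only [hexagonEdges_rotate] using key h.rotate.rotate hm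
    · simpa only [hexagonEdges_rotate] using key h.rotate.rotate.rotate hm
    · simpa only [hexagonEdges_rotate] using key h.rotate.rotate.rotate.rotate hm
    · simpa only [hexagonEdges_rotate] using key h.rotate.rotate.rotate.rotate.rotate hm
    · exact key h hm
  rcases Sym2.eq_iff.mp hfa with ⟨rfl, rfl⟩ | ⟨rfl, rfl⟩
  · exact ⟨e, d, c, b, h.reverse, (hexagonEdges_reverse ..).symm⟩
  · exact ⟨b, c, d, e, h, rfl⟩

/-- The edge sets of the cycles of length six through the edge `uv`. -/
theorem setOf_sixCycle_eq (hg : 6 ≤ G.girth) (u v : V) :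
    {s : Set (Sym2 V) |
      (∃ (v : V) (w : G.Walk v v), w.IsCycle ∧ w.length = 6 ∧ s = {e' | e' ∈ w.edges}) ∧
        s(u, v) ∈ s} =
      {s | ∃ p x y q, G.IsHexagon u p x y q v ∧ s = hexagonEdges u p x y q v} := by
  ext s
  simp only [Set.mem_ofPred_eq, exists_isCycle_length_eq_six_iff hg]
  constructor
  · rintro ⟨⟨a, b, c, d, e, f, h, rfl⟩, hm⟩
    exact h.exists_of_mem hm
  · rintro ⟨p, x, y, q, h, rfl⟩
    exact ⟨⟨u, p, x, y, q, v, h, rfl⟩, by simp [hexagonEdges, Sym2.eq_swap (a := u) (b := v)]⟩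

theorem sixCycleCount_eq_zero_iff [Finite V] (hg : 6 ≤ G.girth) (u v : V) :
    sixCycleCount G s(u, v) = 0 ↔ ∀ p x y q, ¬ G.IsHexagon u p x y q v := by
  rw [sixCycleCount, setOf_sixCycle_eq hg, Set.ncard_eq_zero (Set.toFinite _),
    Set.eq_empty_iff_forall_notMem]
  simp only [Set.mem_ofPred_eq]
  grind

/-- `p` enumerates the two neighbours of `u` other than its neighbour `v`. -/
structure IsBranch (G : SimpleGraph V) (u v : V) (p : Fin 2 → V) : Prop where
  injective : Function.Injective p
  ne : ∀ i, p i ≠ v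
  adj_iff : ∀ n, G.Adj u n ↔ n = v ∨ ∃ i, n = p i

theorem exists_isBranch (hcubic : ∀ v : V, (G.neighborSet v).ncard = 3) {u v : V}
    (huv : G.Adj u v) : ∃ p, G.IsBranch u v p := by
  obtain ⟨x, y, z, hxy, hxz, hyz, h⟩ := Set.ncard_eq_three.mp (hcubic u)
  have hadj : ∀ n, G.Adj u n ↔ n = x ∨ n = y ∨ n = z := by
    intro n
    rw [← mem_neighborSet, h]
    simp
  have key : ∀ y z, y ≠ z → y ≠ v → z ≠ v → (∀ n, G.Adj u n ↔ n = v ∨ n = y ∨ n = z) →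
      ∃ p, G.IsBranch u v p := by
    intro y z hyz hy hz h
    refine ⟨![y, z], ?_, ?_, ?_⟩
    · intro i j
      fin_cases i <;> fin_cases j <;> simp [hyz, hyz.symm]
    · intro i
      fin_cases i <;> simp [hy, hz]
    · intro n
      rw [h]
      simp [Fin.exists_fin_two]
  rcases (hadj v).mp huv with rfl | rfl | rfl
  · exact key y z hyz hxy.symm hxz.symm hadj
  · exact key x z hxz hxy hyz.symm (by grind)
  · exact key x y hxy hxz hyz (by grind)

/-- The vertices at distance at most two from the edge `uv`: `p` and `q` enumerate the other
neighbours of `u` and `v`, and `f i` and `g k` the other neighbours of `p i` and `q k`. -/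
structure IsEdgeTree (G : SimpleGraph V) (u v : V) (p q : Fin 2 → V) (f g : Fin 2 → Fin 2 → V) :
    Prop where
  adj : G.Adj u v
  left : G.IsBranch u v p
  right : G.IsBranch v u q
  left_left : ∀ i, G.IsBranch (p i) u (f i)
  right_right : ∀ k, G.IsBranch (q k) v (g k)

namespace IsBranch

variable {u v : V} {p : Fin 2 → V}

theorem adj (h : G.IsBranch u v p) (i : Fin 2) : G.Adj u (p i) :=
  (h.adj_iff _).mpr (.inr ⟨i, rfl⟩)

theorem exists_eq (h : G.IsBranch u v p) {n : V} (hn : G.Adj u n) (hv : n ≠ v) : ∃ i, n = p i :=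
  ((h.adj_iff n).mp hn).resolve_left hv

end IsBranch

theorem exists_isEdgeTree (hcubic : ∀ v : V, (G.neighborSet v).ncard = 3) {u v : V}
    (huv : G.Adj u v) : ∃ p q f g, G.IsEdgeTree u v p q f g := by
  obtain ⟨p, hp⟩ := exists_isBranch hcubic huv
  obtain ⟨q, hq⟩ := exists_isBranch hcubic huv.symm
  choose f hf using fun i ↦ exists_isBranch hcubic (hp.adj i).symm
  choose g hg using fun i ↦ exists_isBranch hcubic (hq.adj i).symm
  exact ⟨p, q, f, g, huv, hp, hq, hf, hg⟩

namespace IsEdgeTree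

variable {u v : V} {p q : Fin 2 → V} {f g : Fin 2 → Fin 2 → V}

theorem symm (h : G.IsEdgeTree u v p q f g) : G.IsEdgeTree v u q p g f :=
  ⟨h.adj.symm, h.right, h.left, h.right_right, h.left_left⟩

section

variable (h : G.IsEdgeTree u v p q f g) (hg : 6 ≤ G.girth)
include h hg

theorem left_left_inj {i j i' j' : Fin 2} (he : f i j = f i' j') : i = i' ∧ j = j' := by
  have hi : i = i' := by
    refine h.left.injective (((eq_or_eq_of_six_le_girth hg (h.left.adj i)
      ((h.left_left i).adj j) ?_ (h.left.adj i').symm).resolve_left ((h.left_left i).ne j).symm))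
    rw [he]
    exact ((h.left_left i').adj j').symm
  subst hi
  exact ⟨rfl, (h.left_left i).injective he⟩

theorem left_left_ne_right_right (i j k l : Fin 2) : f i j ≠ g k l := fun he ↦
  not_adj_of_six_le_girth_of_pentagon hg (h.left.adj i) ((h.left_left i).adj j)
    (he ▸ ((h.right_right k).adj l).symm) (h.right.adj k).symm h.adj.symm

theorem left_left_ne_endpoint (i j : Fin 2) : f i j ≠ v := fun he ↦
  not_adj_of_six_le_girth_of_triangle hg (h.left.adj i) ((h.left_left i).adj j)
    (he ▸ h.adj.symm)

theorem left_left_ne_left (i j i' : Fin 2) : f i j ≠ p i' := fun he ↦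
  not_adj_of_six_le_girth_of_triangle hg (h.left.adj i) ((h.left_left i).adj j)
    (he ▸ (h.left.adj i').symm)

theorem left_left_ne_right (i j k : Fin 2) : f i j ≠ q k := fun he ↦
  (eq_or_eq_of_six_le_girth hg (h.left.adj i) (he ▸ (h.left_left i).adj j)
    (h.right.adj k).symm h.adj.symm).elim (h.right.ne k).symm (h.left.ne i)

theorem isHexagon {i j k l : Fin 2} (ha : G.Adj (f i j) (g k l)) :
    G.IsHexagon u (p i) (f i j) (g k l) (q k) v :=
  ⟨h.left.adj i, (h.left_left i).adj j, ha, ((h.right_right k).adj l).symm, (h.right.adj k).symm,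
    h.adj.symm, ((h.left_left i).ne j).symm, (h.symm.left_left_ne_right hg k l i).symm,
    h.left_left_ne_right hg i j k, (h.right_right k).ne l, h.right.ne k, (h.left.ne i).symm⟩

theorem sixCycleCount_eq [∀ i j k l, Decidable (G.Adj (f i j) (g k l))] :
    sixCycleCount G s(u, v) = ∑ i, ∑ j, ∑ k, ∑ l, (decide (G.Adj (f i j) (g k l))).toNat := by
  have himage : {s | ∃ p x y q, G.IsHexagon u p x y q v ∧ s = hexagonEdges u p x y q v} =
      (fun t : Fin 2 × Fin 2 × Fin 2 × Fin 2 ↦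
        hexagonEdges u (p t.1) (f t.1 t.2.1) (g t.2.2.1 t.2.2.2) (q t.2.2.1) v) ''
      {t | G.Adj (f t.1 t.2.1) (g t.2.2.1 t.2.2.2)} := by
    ext s
    constructor
    · rintro ⟨p', x, y, q', hh, rfl⟩
      obtain ⟨i, rfl⟩ := h.left.exists_eq hh.ab hh.fb.symm
      obtain ⟨j, rfl⟩ := (h.left_left i).exists_eq hh.bc hh.ac.symm
      obtain ⟨k, rfl⟩ := h.right.exists_eq hh.ef.symm hh.ea
      obtain ⟨l, rfl⟩ := (h.right_right k).exists_eq hh.de.symm hh.df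
      exact ⟨(i, j, k, l), hh.cd, rfl⟩
    · rintro ⟨t, ht, rfl⟩
      exact ⟨_, _, _, _, h.isHexagon hg ht, rfl⟩
  have hinj : Function.Injective (fun t : Fin 2 × Fin 2 × Fin 2 × Fin 2 ↦
      hexagonEdges u (p t.1) (f t.1 t.2.1) (g t.2.2.1 t.2.2.2) (q t.2.2.1) v) := by
    rintro ⟨i, j, k, l⟩ ⟨i', j', k', l'⟩ he
    dsimp only at he
    have hm : s(f i j, g k l) ∈ hexagonEdges u (p i') (f i' j') (g k' l') (q k') v := by
      rw [← he]
      simp [hexagonEdges]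
    have h1 := (h.left_left i).ne j
    have h2 := (h.right_right k).ne l
    have h3 := h.left_left_ne_endpoint hg i j
    have h4 := h.symm.left_left_ne_endpoint hg k l
    have h5 := h.left_left_ne_left hg i j i'
    have h6 := h.symm.left_left_ne_left hg k l k'
    have h7 := h.symm.left_left_ne_right hg k l i'
    have h8 := h.left_left_ne_right_right hg i j k' l'
    have h9 := h.left_left_ne_right hg i j k'
    simp [hexagonEdges, h1, h2, h3, h4, h5, h6, h7, h8, h9] at hm
    obtain ⟨rfl, rfl⟩ := h.left_left_inj hg hm.1
    obtain ⟨rfl, rfl⟩ := h.symm.left_left_inj hg hm.2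
    rfl
  rw [sixCycleCount, setOf_sixCycle_eq hg, himage, Set.ncard_image_of_injective _ hinj,
    Set.ncard_eq_toFinset_card']
  simp only [Set.toFinset_ofPred, Finset.card_filter, Fintype.sum_prod_type, Bool.toNat,
    Bool.cond_decide]

end

end IsEdgeTree

theorem eq_or_eq_or_eq_of_adj (hcubic : ∀ v : V, (G.neighborSet v).ncard = 3) {x a b c n : V}
    (ha : G.Adj x a) (hb : G.Adj x b) (hc : G.Adj x c) (hab : a ≠ b) (hac : a ≠ c) (hbc : b ≠ c)
    (hn : G.Adj x n) : n = a ∨ n = b ∨ n = c := by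
  obtain ⟨x', y', z', -, -, -, h⟩ := Set.ncard_eq_three.mp (hcubic x)
  have hadj : ∀ n, G.Adj x n → n = x' ∨ n = y' ∨ n = z' := by
    intro n hn
    rw [← mem_neighborSet, h] at hn
    simpa using hn
  have := hadj a ha; have := hadj b hb; have := hadj c hc; have := hadj n hn
  grind

/-- One side of the bipartition of the vertices at distance at most two from an edge. -/
def edgeTreeSide (u : V) (q : Fin 2 → V) (f : Fin 2 → Fin 2 → V) : Set V :=
  {n | n = u ∨ (∃ k, n = q k) ∨ ∃ i j, n = f i j}

namespace IsEdgeTree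

variable {u v : V} {p q : Fin 2 → V} {f g : Fin 2 → Fin 2 → V}

theorem mem_edgeTreeSide_of_adj (h : G.IsEdgeTree u v p q f g) (hg : 6 ≤ G.girth)
    (hcubic : ∀ v : V, (G.neighborSet v).ncard = 3) {i j : Fin 2}
    (hrow : ∀ i' j', (i' = i → j' ≠ j) →
      ∃ l₀ l₁, G.Adj (f i' j') (g 0 l₀) ∧ G.Adj (f i' j') (g 1 l₁))
    {x n : V} (hx : x ∈ edgeTreeSide u q f) (hne : x ≠ f i j) (hn : G.Adj x n) :
    n ∈ edgeTreeSide v p g := by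
  rcases hx with rfl | ⟨k, rfl⟩ | ⟨i', j', rfl⟩
  · rcases (h.left.adj_iff n).mp hn with rfl | ⟨i, rfl⟩
    · exact .inl rfl
    · exact .inr (.inl ⟨i, rfl⟩)
  · rcases ((h.right_right k).adj_iff n).mp hn with rfl | ⟨l, rfl⟩
    · exact .inl rfl
    · exact .inr (.inr ⟨k, l, rfl⟩)
  · obtain ⟨l₀, l₁, h₀, h₁⟩ := hrow i' j' (by rintro rfl rfl; exact hne rfl)
    rcases eq_or_eq_or_eq_of_adj hcubic ((h.left_left i').adj j').symm h₀ h₁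
      (h.symm.left_left_ne_right hg 0 l₀ i').symm (h.symm.left_left_ne_right hg 1 l₁ i').symm
      (fun he ↦ by simpa using (h.symm.left_left_inj hg he).1) hn with rfl | rfl | rfl
    · exact .inr (.inl ⟨i', rfl⟩)
    · exact .inr (.inr ⟨0, l₀, rfl⟩)
    · exact .inr (.inr ⟨1, l₁, rfl⟩)

/-- In the path pattern, the third edge at one end of the path lies on no hexagon. -/
theorem exists_adj_forall_not_isHexagon [∀ i j k l, Decidable (G.Adj (f i j) (g k l))]
    (h : G.IsEdgeTree u v p q f g) (hg : 6 ≤ G.girth)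
    (hcubic : ∀ v : V, (G.neighborSet v).ncard = 3) {i j k l : Fin 2}
    (hM : IsPathPattern (fun i j k l ↦ decide (G.Adj (f i j) (g k l))) i j k l) :
    ∃ x n, G.Adj x n ∧ ∀ a b c d, ¬ G.IsHexagon x a b c d n := by
  simp only [IsPathPattern, decide_eq_true_eq] at hM
  obtain ⟨⟨k₀, l₀, h₀, huniq⟩, hrow, hcol, hrow', hcol', hpath⟩ := hM
  have hcol : ∀ k' l', (k' = k → l' ≠ l) →
      ∃ j₀ j₁, G.Adj (g k' l') (f 0 j₀) ∧ G.Adj (g k' l') (f 1 j₁) := by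
    simpa only [G.adj_comm] using hcol
  obtain ⟨t, ht⟩ := exists_isBranch hcubic ((h.left_left i).adj j).symm
  obtain ⟨n, hxn, hnp, hng⟩ : ∃ n, G.Adj (f i j) n ∧ n ≠ p i ∧ n ≠ g k₀ l₀ := by
    by_cases ht₀ : t 0 = g k₀ l₀
    · exact ⟨t 1, ht.adj 1, ht.ne 1, fun he ↦ by simpa using ht.injective (he.trans ht₀.symm)⟩
    · exact ⟨t 0, ht.adj 0, ht.ne 0, ht₀⟩
  have hnB : n ∉ edgeTreeSide v p g := by
    rintro (rfl | ⟨i', rfl⟩ | ⟨k', l', rfl⟩)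
    · exact (eq_or_eq_of_six_le_girth hg (h.left.adj i) ((h.left_left i).adj j) hxn
        h.adj.symm).elim ((h.left_left i).ne j).symm (h.left.ne i)
    · refine hnp (((eq_or_eq_of_six_le_girth hg (h.left.adj i)
        ((h.left_left i).adj j) hxn (h.left.adj i').symm).resolve_left
          ((h.left_left i).ne j).symm).symm)
    · obtain ⟨rfl, rfl⟩ := huniq k' l' hxn
      exact hng rfl
  have hA {x n : V} := h.mem_edgeTreeSide_of_adj (x := x) (n := n) hg hcubic hrow
  have hB {x n : V} := h.symm.mem_edgeTreeSide_of_adj (x := x) (n := n) hg hcubic hcol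
  refine ⟨f i j, n, hxn, fun a b c d hh ↦ ?_⟩
  have hp_ne : p i ≠ g k l := (h.symm.left_left_ne_right hg k l i).symm
  have ha : a = p i ∨ a = g k₀ l₀ :=
    (eq_or_eq_or_eq_of_adj hcubic ((h.left_left i).adj j).symm h₀ hxn
      (h.symm.left_left_ne_right hg k₀ l₀ i).symm hnp.symm hng.symm hh.ab).imp_right
      (·.resolve_right hh.fb.symm)
  have haB : a ∈ edgeTreeSide v p g := by
    rcases ha with rfl | rfl
    · exact .inr (.inl ⟨i, rfl⟩)
    · exact .inr (.inr ⟨k₀, l₀, rfl⟩)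
  have hay : a ≠ g k l := by
    rcases ha with rfl | rfl
    · exact hp_ne
    · exact fun he ↦ hrow' l (he ▸ h₀)
  have hbA := hB haB hay hh.bc
  have hcB := hA hbA hh.ac.symm hh.cd
  have hcy : c ≠ g k l := by
    rintro rfl
    have hab := hh.bc
    have hbc := hh.cd
    rcases hbA with rfl | ⟨k', rfl⟩ | ⟨i', j', rfl⟩
    · obtain ⟨i', hi'⟩ := h.left.exists_eq hbc ((h.right_right k).ne l)
      exact h.symm.left_left_ne_right hg k l i' hi'
    · obtain ⟨l', hl'⟩ := (h.right_right k').exists_eq hbc ((h.right_right k).ne l)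
      obtain ⟨rfl, -⟩ := h.symm.left_left_inj hg hl'
      rcases ha with rfl | rfl
      · obtain ⟨l', hl'⟩ := (h.right_right k).exists_eq hab.symm (h.left.ne i)
        exact h.symm.left_left_ne_right hg k l' i hl'.symm
      · obtain ⟨l', hl'⟩ := (h.right_right k).exists_eq hab.symm ((h.right_right k₀).ne l₀)
        exact hrow' l' (hl' ▸ h₀)
    · rcases ha with rfl | rfl
      · obtain ⟨j'', hj''⟩ := (h.left_left i).exists_eq hab ((h.left_left i').ne j')
        exact hcol' j'' (hj'' ▸ hbc)
      · exact hpath i' j' k₀ l₀ h₀ hab.symm hbc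
  have hdA := hB hcB hcy hh.de
  exact hnB (hA hdA hh.ea hh.ef)

/-- The pattern of adjacencies around an edge that lies on exactly seven cycles of length six. -/
theorem exists_isPathPattern [∀ i j k l, Decidable (G.Adj (f i j) (g k l))]
    (h : G.IsEdgeTree u v p q f g) (hg : 6 ≤ G.girth) (hcount : sixCycleCount G s(u, v) = 7) :
    ∃ i j k l, IsPathPattern (fun i j k l ↦ decide (G.Adj (f i j) (g k l))) i j k l := by
  refine _root_.exists_isPathPattern _ ?_ ?_ ?_ (h.sixCycleCount_eq hg ▸ hcount)
  · intro i j k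
    rw [Bool.eq_false_iff]
    simp only [ne_eq, Bool.and_eq_true, decide_eq_true_eq]
    rintro ⟨h₀, h₁⟩
    rcases eq_or_eq_of_six_le_girth hg h₀ ((h.right_right k).adj 0).symm
      ((h.right_right k).adj 1) h₁.symm with he | he
    · exact h.left_left_ne_right hg i j k he
    · simpa using (h.right_right k).injective he
  · intro i k l
    rw [Bool.eq_false_iff]
    simp only [ne_eq, Bool.and_eq_true, decide_eq_true_eq]
    rintro ⟨h₀, h₁⟩
    rcases eq_or_eq_of_six_le_girth hg h₀ h₁.symm ((h.left_left i).adj 1).symm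
      ((h.left_left i).adj 0) with he | he
    · simpa using (h.left_left i).injective he
    · exact h.symm.left_left_ne_right hg k l i he
  · intro i j i' j' k l k' l'
    simp only [decide_eq_true_eq]
    intro h₁ h₂ h₃ h₄
    exact (eq_or_eq_of_six_le_girth hg h₁ h₃.symm h₄ h₂.symm).imp (h.left_left_inj hg)
      (h.symm.left_left_inj hg)

/-- Around an edge `uv` with the path pattern, every edge at `u` lies on a hexagon. -/
theorem exists_isHexagon_of_adj [∀ i j k l, Decidable (G.Adj (f i j) (g k l))]
    (h : G.IsEdgeTree u v p q f g) (hg : 6 ≤ G.girth) {i j k l : Fin 2}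
    (hM : IsPathPattern (fun i j k l ↦ decide (G.Adj (f i j) (g k l))) i j k l) {n : V}
    (hn : G.Adj u n) : ∃ a b c d, G.IsHexagon u a b c d n := by
  simp only [IsPathPattern, decide_eq_true_eq] at hM
  obtain ⟨⟨k₀, l₀, h₀, -⟩, hrow, -⟩ := hM
  have hex : ∀ i', ∃ j' k' l', G.Adj (f i' j') (g k' l') := by
    intro i'
    by_cases hi : i' = i
    · exact ⟨j, k₀, l₀, hi ▸ h₀⟩
    · obtain ⟨l', -, hl', -⟩ := hrow i' 0 fun he ↦ (hi he).elim
      exact ⟨0, 0, l', hl'⟩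
  rcases (h.left.adj_iff n).mp hn with rfl | ⟨i', rfl⟩
  · exact ⟨_, _, _, _, h.isHexagon hg h₀⟩
  · obtain ⟨j', k', l', ha⟩ := hex i'
    exact ⟨_, _, _, _, (h.isHexagon hg ha).rotate.reverse⟩

end IsEdgeTree

end SimpleGraph

/-- There is no finite simple cubic girth-regular graph of girth 6
whose signature `(a, b, c)` (with `a ≤ b ≤ c`) has `c = 7`. -/
theorem no_cubic_girth_six_signature_c_eq_seven {V : Type*} [Fintype V] (Γ : SimpleGraph V)
    (hcubic : ∀ v : V, (Γ.neighborSet v).ncard = 3)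
    (hgirth : Γ.girth = 6)
    (a b : ℕ) (hab : a ≤ b) (hb : b ≤ 7) :
    ¬ hasSignature Γ a b 7 := by
  classical
  intro hsig
  have hg : 6 ≤ Γ.girth := hgirth.ge
  obtain ⟨u⟩ : Nonempty V := by
    have hac : ¬ Γ.IsAcyclic := fun hac ↦ by
      simp [SimpleGraph.girth_eq_zero.mpr hac] at hgirth
    obtain ⟨u, -⟩ := SimpleGraph.exists_girth_eq_length.mpr hac
    exact ⟨u⟩
  have hzero := SimpleGraph.sixCycleCount_eq_zero_iff hg
  obtain ⟨e₁, e₂, e₃, -, -, -, hinc, h₁, h₂, h₃⟩ := hsig u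
  obtain ⟨v, huv, rfl⟩ : ∃ v, Γ.Adj u v ∧ e₃ = s(u, v) := by
    have he : e₃ ∈ Γ.incidenceSet u := by simp [hinc]
    obtain ⟨v, rfl⟩ := Sym2.mem_iff_exists.mp he.2
    exact ⟨v, he.1, rfl⟩
  obtain ⟨w, huw, rfl⟩ : ∃ w, Γ.Adj u w ∧ e₁ = s(u, w) := by
    have he : e₁ ∈ Γ.incidenceSet u := by simp [hinc]
    obtain ⟨w, rfl⟩ := Sym2.mem_iff_exists.mp he.2
    exact ⟨w, he.1, rfl⟩
  obtain ⟨p, q, f, g, h⟩ := SimpleGraph.exists_isEdgeTree hcubic huv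
  obtain ⟨i, j, k, l, hM⟩ := h.exists_isPathPattern hg h₃
  obtain ⟨x, n, hxn, hn⟩ := h.exists_adj_forall_not_isHexagon hg hcubic hM
  have ha : a = 0 := by
    obtain ⟨e₁', e₂', e₃', -, -, -, hinc', h₁', h₂', h₃'⟩ := hsig x
    have he : s(x, n) ∈ Γ.incidenceSet x := ⟨hxn, Sym2.mem_mk_left x n⟩
    rw [hinc'] at he
    have h₀ := (hzero x n).mpr hn
    rcases he with rfl | rfl | rfl <;> omega
  obtain ⟨c₁, c₂, c₃, c₄, hc⟩ := h.exists_isHexagon_of_adj hg hM huw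
  exact (hzero u w).mp (h₁.trans ha) _ _ _ _ hc
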